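/- arXiv:1106.1651 — 7 statements merged into one kernel-verified Lean document; each statement's English description precedes it below -/
import Mathlib

section
/- Let N, K be positive integers with K ≤ N, let v ∈ ℝ^N with v ≠ 0, and let I be a K-element subset of {1,…,N} such that |v_j| ≤ |v_i| for every i ∈ I and j ∉ I. Define x ∈ ℝ^N by x_i = v_i/‖v_I‖ for i ∈ I and x_i = 0 for i ∉ I, where v_I denotes the restriction of v to the indices in I (note ‖v_I‖ > 0 since v ≠ 0 and I collects K absolutely largest entries). Then x ∈ S_K^N and |⟨v, x⟩| = ‖v_I‖ = max_{y ∈ S_K^N} |⟨v, y⟩|. -/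
open Real Set Matrix

/-- `sparseUnit N K` is the set `S_K^N` of vectors in `ℝ^N` with Euclidean norm 1
and at most `K` nonzero entries. -/
def sparseUnit (N K : ℕ) : Set (Fin N → ℝ) :=
  {x | Real.sqrt (∑ i, x i ^ 2) = 1 ∧ {i | x i ≠ 0}.ncard ≤ K}

/-- A sum of nonnegative terms over a set `T` of size at most `#I` is at most the sum over `I`,
when every term in `I` dominates every term outside `I`. -/
theorem Finset.sum_le_sum_of_card_le_of_dominating {ι : Type*} [DecidableEq ι] {I T : Finset ι}
    {f : ι → ℝ} (hf : ∀ i, 0 ≤ f i) (hI : ∀ i ∈ I, ∀ j ∉ I, f j ≤ f i) (hT : T.card ≤ I.card) :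
    ∑ i ∈ T, f i ≤ ∑ i ∈ I, f i := by
  rw [← Finset.sum_sdiff_le_sum_sdiff]
  rcases (T \ I).eq_empty_or_nonempty with h | h
  · rw [h, Finset.sum_empty]
    exact Finset.sum_nonneg fun i _ => hf i
  obtain ⟨m, hm, hmax⟩ := Finset.exists_max_image (T \ I) f h
  calc ∑ i ∈ T \ I, f i ≤ (T \ I).card • f m := Finset.sum_le_card_nsmul _ _ _ hmax
    _ ≤ (I \ T).card • f m :=
        nsmul_le_nsmul_left (hf m) (Finset.card_sdiff_le_card_sdiff_iff.mpr hT)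
    _ ≤ ∑ i ∈ I \ T, f i := Finset.card_nsmul_le_sum _ _ _ fun i hi =>
        hI i (Finset.mem_sdiff.mp hi).1 m (Finset.mem_sdiff.mp hm).2

/-- The pairing of `v` with a sparse unit vector is bounded by the norm of the restriction of `v`
to a set of indices of its absolutely largest entries. -/
theorem abs_sum_mul_le_of_mem_sparseUnit {N K : ℕ} {v y : Fin N → ℝ} {I : Finset (Fin N)}
    (hI : I.card = K) (hlarge : ∀ i ∈ I, ∀ j ∉ I, |v j| ≤ |v i|) (hy : y ∈ sparseUnit N K) :
    |∑ i, v i * y i| ≤ Real.sqrt (∑ i ∈ I, v i ^ 2) := by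
  obtain ⟨hnorm, hcard⟩ := hy
  set T : Finset (Fin N) := {i | y i ≠ 0} with hT
  have hTcard : T.card ≤ I.card := by
    rw [hI, ← Set.ncard_coe_finset]
    simpa [hT] using hcard
  have hsupp : ∀ i ∉ T, y i = 0 := by simp [hT]
  have hsum : ∑ i, v i * y i = ∑ i ∈ T, v i * y i :=
    (Finset.sum_subset (Finset.subset_univ T) fun i _ hi => by simp [hsupp i hi]).symm
  have hsq : ∑ i ∈ T, y i ^ 2 = 1 := by
    rw [Finset.sum_subset (Finset.subset_univ T) fun i _ hi => by simp [hsupp i hi]]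
    exact Real.sqrt_eq_one.mp hnorm
  have hcs := Finset.sum_mul_sq_le_sq_mul_sq T v y
  rw [hsq, mul_one] at hcs
  rw [hsum]
  exact Real.abs_le_sqrt (hcs.trans (Finset.sum_le_sum_of_card_le_of_dominating
    (fun i => sq_nonneg (v i)) (fun i hi j hj => sq_le_sq.mpr (hlarge i hi j hj)) hTcard))

theorem stmt2 (N K : ℕ) (hN : 0 < N) (hK : 0 < K) (hKN : K ≤ N)
    (v : Fin N → ℝ) (hv : v ≠ 0)
    (I : Finset (Fin N)) (hI : I.card = K)
    (hlarge : ∀ i ∈ I, ∀ j ∉ I, |v j| ≤ |v i|)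
    (x : Fin N → ℝ)
    (hx : ∀ i, x i = if i ∈ I then v i / Real.sqrt (∑ i ∈ I, v i ^ 2) else 0) :
    x ∈ sparseUnit N K ∧
    |∑ i, v i * x i| = Real.sqrt (∑ i ∈ I, v i ^ 2) ∧
    IsGreatest ((fun y => |∑ i, v i * y i|) '' sparseUnit N K)
      (Real.sqrt (∑ i ∈ I, v i ^ 2)) := by
  have hpos : 0 < ∑ i ∈ I, v i ^ 2 := by
    obtain ⟨j, hj⟩ := Function.ne_iff.mp hv
    obtain ⟨i, hi⟩ := Finset.card_pos.mp (hI ▸ hK)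
    refine Finset.sum_pos' (fun i _ => sq_nonneg (v i)) ?_
    by_cases hjI : j ∈ I
    · exact ⟨j, hjI, sq_pos_of_ne_zero hj⟩
    · exact ⟨i, hi, sq_pos_of_ne_zero
        (abs_pos.mp ((abs_pos.mpr hj).trans_le (hlarge i hi j hjI)))⟩
  have hsq := Real.sq_sqrt hpos.le
  have hsqrt := Real.sqrt_pos.mpr hpos
  set s := Real.sqrt (∑ i ∈ I, v i ^ 2)
  have hmem : x ∈ sparseUnit N K := by
    constructor
    · rw [Real.sqrt_eq_one]
      simp only [hx, ite_pow, ne_eq, OfNat.ofNat_ne_zero, not_false_eq_true, zero_pow,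
        Finset.sum_ite_mem, Finset.univ_inter, div_pow]
      rw [← Finset.sum_div, hsq, div_self hpos.ne']
    · rw [← hI, ← Set.ncard_coe_finset]
      refine Set.ncard_le_ncard (fun i hi => ?_) I.finite_toSet
      by_contra h
      exact hi ((hx i).trans (if_neg h))
  have hval : |∑ i, v i * x i| = s := by
    simp only [hx, mul_ite, mul_zero, Finset.sum_ite_mem, Finset.univ_inter, ← mul_div_assoc,
      ← pow_two]
    rw [← Finset.sum_div, ← hsq, pow_two, mul_div_cancel_right₀ _ hsqrt.ne', abs_of_pos hsqrt]
  refine ⟨hmem, hval, ⟨x, hmem, hval⟩, ?_⟩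
  rintro _ ⟨y, hy, rfl⟩
  exact abs_sum_mul_le_of_mem_sparseUnit hI hlarge hy
end

section
/- Let D ≥ 2 be an integer and let u ∈ ℝ^D be a unit vector. Then exactly one of the two vectors u and -u lies in the image of the hyperpolar map, i.e. exactly one of the statements '∃ φ ∈ (-π/2, π/2]^{D-1} with c(φ) = u' and '∃ φ ∈ (-π/2, π/2]^{D-1} with c(φ) = -u' holds. -/
open Real Set Matrix

/-- The hyperpolar vector `c(φ) ∈ ℝ^D` of angles `φ = (φ_1, …, φ_{D-1})`:
`c(φ)_k = cos φ_1 ⋯ cos φ_{k-1} · sin φ_k` for `k < D` and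
`c(φ)_D = cos φ_1 ⋯ cos φ_{D-1}` (indices here are 0-based). -/
noncomputable def hyperpolar (D : ℕ) (φ : Fin (D - 1) → ℝ) : Fin D → ℝ :=
  fun k =>
    (∏ j ∈ Finset.univ.filter (fun j : Fin (D - 1) => (j : ℕ) < (k : ℕ)), Real.cos (φ j)) *
      (if h : (k : ℕ) < D - 1 then Real.sin (φ ⟨k, h⟩) else 1)

/-- The image of the box `(-π/2, π/2]^n` under the hyperpolar map. -/
def hyperpolarImage (n : ℕ) : Set (Fin (n + 1) → ℝ) :=
  {u | ∃ φ : Fin n → ℝ, (∀ j, φ j ∈ Set.Ioc (-(π / 2)) (π / 2)) ∧ hyperpolar (n + 1) φ = u}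

theorem hyperpolar_one (φ : Fin 0 → ℝ) : hyperpolar 1 φ = 1 := by
  ext k
  simp [hyperpolar]

theorem hyperpolar_zero (n : ℕ) (φ : Fin (n + 1) → ℝ) :
    hyperpolar (n + 2) φ 0 = Real.sin (φ 0) := by
  simp [hyperpolar]

theorem hyperpolar_succ (n : ℕ) (φ : Fin (n + 1) → ℝ) (k : Fin (n + 1)) :
    hyperpolar (n + 2) φ k.succ = Real.cos (φ 0) * hyperpolar (n + 1) (Fin.tail φ) k := by
  unfold hyperpolar
  rw [← mul_assoc]
  congr 1
  · simp only [Finset.prod_filter]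
    refine (Fin.prod_univ_succ (n := n) _).trans ?_
    simp [Fin.tail]
  · simp [Fin.tail]

theorem mem_hyperpolarImage_succ_iff {n : ℕ} {u : Fin (n + 2) → ℝ} {r : ℝ} (hr : 0 < r)
    (hur : u 0 ^ 2 + r ^ 2 = 1) :
    u ∈ hyperpolarImage (n + 1) ↔ r⁻¹ • Fin.tail u ∈ hyperpolarImage n := by
  constructor
  · rintro ⟨φ, hφ, rfl⟩
    refine ⟨Fin.tail φ, fun j => hφ j.succ, ?_⟩
    rw [hyperpolar_zero] at hur
    have hcos : 0 ≤ Real.cos (φ 0) := Real.cos_nonneg_of_mem_Icc (Set.Ioc_subset_Icc_self (hφ 0))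
    have hcr : Real.cos (φ 0) = r := by
      nlinarith [Real.sin_sq_add_cos_sq (φ 0)]
    ext k
    simp only [Pi.smul_apply, smul_eq_mul]
    change _ = r⁻¹ * hyperpolar (n + 2) φ k.succ
    rw [hyperpolar_succ, hcr, inv_mul_cancel_left₀ hr.ne']
  · rintro ⟨ψ, hψ, h⟩
    have h1 : -1 < u 0 := by nlinarith [sq_pos_of_pos hr]
    have h2 : u 0 ≤ 1 := by nlinarith [sq_pos_of_pos hr]
    refine ⟨Fin.cons (Real.arcsin (u 0)) ψ, ?_, ?_⟩
    · refine Fin.cases ?_ (fun j => ?_)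
      · exact ⟨Real.neg_pi_div_two_lt_arcsin.2 h1, Real.arcsin_le_pi_div_two _⟩
      · exact hψ j
    · ext k
      refine Fin.cases ?_ (fun j => ?_) k
      · rw [hyperpolar_zero, Fin.cons_zero, Real.sin_arcsin h1.le h2]
      · rw [hyperpolar_succ, Fin.cons_zero, Fin.tail_cons, h, Real.cos_arcsin,
          ← hur, add_sub_cancel_left, Real.sqrt_sq hr.le]
        simp [Fin.tail, hr.ne']

theorem mem_hyperpolarImage_iff_of_tail_eq_zero {n : ℕ} {u : Fin (n + 2) → ℝ}
    (htail : Fin.tail u = 0) (hu : u 0 ^ 2 = 1) :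
    u ∈ hyperpolarImage (n + 1) ↔ u 0 = 1 := by
  constructor
  · rintro ⟨φ, hφ, rfl⟩
    refine (sq_eq_one_iff.1 hu).resolve_right ?_
    rw [hyperpolar_zero]
    intro h
    have := Real.arcsin_sin (hφ 0).1.le (hφ 0).2
    rw [h, Real.arcsin_neg_one] at this
    exact (hφ 0).1.ne this
  · intro h
    refine ⟨Fin.cons (π / 2) 0, ?_, ?_⟩
    · refine Fin.cases ?_ (fun j => ?_)
      · exact ⟨by simp only [Fin.cons_zero]; linarith [Real.pi_pos], le_rfl⟩
      · constructor <;> simp [Real.pi_pos, Real.pi_div_two_pos.le]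
    · ext k
      refine Fin.cases ?_ (fun j => ?_) k
      · rw [hyperpolar_zero, Fin.cons_zero, Real.sin_pi_div_two, h]
      · rw [hyperpolar_succ, Fin.cons_zero, Real.cos_pi_div_two, zero_mul]
        exact (congrFun htail j).symm

theorem xor_mem_hyperpolarImage (n : ℕ) (u : Fin (n + 1) → ℝ) (hu : ∑ k, u k ^ 2 = 1) :
    Xor (u ∈ hyperpolarImage n) (-u ∈ hyperpolarImage n) := by
  induction n with
  | zero =>
    have key (v : Fin 1 → ℝ) : v ∈ hyperpolarImage 0 ↔ v 0 = 1 := by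
      constructor
      · rintro ⟨φ, -, rfl⟩
        exact congrFun (hyperpolar_one φ) 0
      · intro h
        refine ⟨Fin.elim0, fun j => j.elim0, (hyperpolar_one _).trans ?_⟩
        ext k
        rw [Subsingleton.elim k 0, h, Pi.one_apply]
    rw [key, key, Pi.neg_apply]
    rw [Fin.sum_univ_one] at hu
    rcases sq_eq_one_iff.1 hu with h | h <;> norm_num [Xor, h]
  | succ n ih =>
    rw [Fin.sum_univ_succ] at hu
    have hs : 0 ≤ ∑ k : Fin (n + 1), u k.succ ^ 2 := Finset.sum_nonneg fun k _ => sq_nonneg _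
    rcases hs.eq_or_lt with h0 | hpos
    · have htail : Fin.tail u = 0 := by
        ext k
        have := (Finset.sum_eq_zero_iff_of_nonneg fun k _ => sq_nonneg (u (Fin.succ k))).1
          h0.symm k (Finset.mem_univ k)
        simpa [Fin.tail] using this
      have hu0 : u 0 ^ 2 = 1 := by linarith
      have htail' : Fin.tail (-u) = 0 := by
        ext k
        simpa [Fin.tail] using congrFun htail k
      rw [mem_hyperpolarImage_iff_of_tail_eq_zero htail hu0,
        mem_hyperpolarImage_iff_of_tail_eq_zero htail' (by simpa using hu0), Pi.neg_apply]
      rcases sq_eq_one_iff.1 hu0 with h | h <;> norm_num [Xor, h]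
    · set r := √(∑ k : Fin (n + 1), u k.succ ^ 2) with hr
      have hr0 : 0 < r := Real.sqrt_pos.2 hpos
      have hr2 : r ^ 2 = ∑ k : Fin (n + 1), u k.succ ^ 2 := Real.sq_sqrt hs
      have hur : u 0 ^ 2 + r ^ 2 = 1 := by rw [hr2, hu]
      have hneg : r⁻¹ • Fin.tail (-u) = -(r⁻¹ • Fin.tail u) := by
        ext k
        simp [Fin.tail]
      rw [mem_hyperpolarImage_succ_iff hr0 hur,
        mem_hyperpolarImage_succ_iff (u := -u) hr0 (by simpa using hur), hneg]
      apply ih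
      simp only [Pi.smul_apply, smul_eq_mul, mul_pow, ← Finset.mul_sum, Fin.tail]
      rw [← hr2, inv_pow, inv_mul_cancel₀ (pow_pos hr0 2).ne']

theorem stmt4 (D : ℕ) (hD : 2 ≤ D) (u : Fin D → ℝ) (hu : ∑ k, u k ^ 2 = 1) :
    Xor'
      (∃ φ : Fin (D - 1) → ℝ,
        (∀ j, φ j ∈ Set.Ioc (-(π / 2)) (π / 2)) ∧ hyperpolar D φ = u)
      (∃ φ : Fin (D - 1) → ℝ,
        (∀ j, φ j ∈ Set.Ioc (-(π / 2)) (π / 2)) ∧ hyperpolar D φ = -u) := by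
  obtain ⟨n, rfl⟩ : ∃ n, D = n + 1 := ⟨D - 1, by omega⟩
  exact xor_mem_hyperpolarImage n u hu
end

section
/- Let N, K, D be positive integers with K ≤ N, and let V be an N×D real matrix. Then max_{x ∈ S_K^N} xᵀVVᵀx exists and equals the maximum over all unit vectors c ∈ ℝ^D of the sum of the K largest squared entries of the vector Vc ∈ ℝ^N. -/
open Real Set Matrix

theorem dotProduct_mul_transpose_mulVec_self {m n : Type*} [Fintype m] [Fintype n]
    (V : Matrix m n ℝ) (x : m → ℝ) :
    x ⬝ᵥ ((V * V.transpose) *ᵥ x) = ∑ k, (V.transpose *ᵥ x) k ^ 2 := by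
  rw [← Matrix.mulVec_mulVec, Matrix.dotProduct_mulVec, ← Matrix.mulVec_transpose]
  simp [dotProduct, sq]

theorem isCompact_sum_sq_eq_one (n : Type*) [Fintype n] :
    IsCompact {c : n → ℝ | ∑ k, c k ^ 2 = 1} := by
  refine (isCompact_Icc (a := fun _ : n => (-1 : ℝ)) (b := fun _ => 1)).of_isClosed_subset
    (isClosed_eq (by fun_prop) continuous_const) fun c (hc : ∑ k, c k ^ 2 = 1) => ?_
  have h : ∀ k, -1 ≤ c k ∧ c k ≤ 1 := fun k => by
    rw [← abs_le, ← sq_le_one_iff_abs_le_one, ← hc]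
    exact Finset.single_le_sum (f := fun k => c k ^ 2) (fun i _ => sq_nonneg _)
      (Finset.mem_univ k)
  exact ⟨fun k => (h k).1, fun k => (h k).2⟩

/-- The partial energy of `V c` over `K` coordinates attains a joint maximum over the choice of
coordinates and over unit vectors `c`. -/
theorem exists_max_sum_sq_mulVec {N K D : ℕ} (hD : 0 < D) (hKN : K ≤ N)
    (V : Matrix (Fin N) (Fin D) ℝ) :
    ∃ (c₀ : Fin D → ℝ) (I₀ : Finset (Fin N)), ∑ k, c₀ k ^ 2 = 1 ∧ I₀.card = K ∧
      ∀ (c : Fin D → ℝ) (I : Finset (Fin N)), ∑ k, c k ^ 2 = 1 → I.card = K →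
        ∑ i ∈ I, (V *ᵥ c) i ^ 2 ≤ ∑ i ∈ I₀, (V *ᵥ c₀) i ^ 2 := by
  have hne : {c : Fin D → ℝ | ∑ k, c k ^ 2 = 1}.Nonempty :=
    ⟨Pi.single ⟨0, hD⟩ 1, by simp [Pi.single_apply, ite_pow]⟩
  have hmax : ∀ I : Finset (Fin N), ∃ c₀ ∈ {c : Fin D → ℝ | ∑ k, c k ^ 2 = 1},
      IsMaxOn (fun c => ∑ i ∈ I, (V *ᵥ c) i ^ 2) {c | ∑ k, c k ^ 2 = 1} c₀ := fun I =>
    (isCompact_sum_sq_eq_one (Fin D)).exists_isMaxOn hne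
      (by simp only [Matrix.mulVec, dotProduct]; fun_prop)
  choose c hc hcmax using hmax
  obtain ⟨I₀, hI₀, hI₀max⟩ := Finset.exists_max_image
    (Finset.powersetCard K (Finset.univ : Finset (Fin N)))
    (fun I => ∑ i ∈ I, (V *ᵥ c I) i ^ 2) (Finset.powersetCard_nonempty.2 (by simpa using hKN))
  refine ⟨c I₀, I₀, hc I₀, (Finset.mem_powersetCard.1 hI₀).2, fun d I hd hI => ?_⟩
  exact (hcmax I hd).trans
    (hI₀max I (Finset.mem_powersetCard.2 ⟨Finset.subset_univ _, hI⟩))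

theorem sum_sq_mulVec_le_of_unit_bound {m n : Type*} [Fintype n]
    (V : Matrix m n ℝ) (I : Finset m) {M : ℝ}
    (h : ∀ c : n → ℝ, ∑ k, c k ^ 2 = 1 → ∑ i ∈ I, (V *ᵥ c) i ^ 2 ≤ M) (w : n → ℝ) :
    ∑ i ∈ I, (V *ᵥ w) i ^ 2 ≤ (∑ k, w k ^ 2) * M := by
  have hs0 : 0 ≤ ∑ k, w k ^ 2 := Finset.sum_nonneg fun k _ => sq_nonneg _
  rcases hs0.eq_or_lt with hs | hs
  · have hw : w = 0 := funext fun k => pow_eq_zero_iff two_ne_zero |>.1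
      ((Finset.sum_eq_zero_iff_of_nonneg fun k _ => sq_nonneg (w k)).1 hs.symm k
        (Finset.mem_univ k))
    simp [hw]
  · have hr : (√(∑ k, w k ^ 2))⁻¹ ^ 2 = (∑ k, w k ^ 2)⁻¹ := by rw [inv_pow, sq_sqrt hs0]
    have := h ((√(∑ k, w k ^ 2))⁻¹ • w) (by
      simp only [Pi.smul_apply, smul_eq_mul, mul_pow, ← Finset.mul_sum, hr]
      exact inv_mul_cancel₀ hs.ne')
    simp only [Matrix.mulVec_smul, Pi.smul_apply, smul_eq_mul, mul_pow, ← Finset.mul_sum,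
      hr] at this
    exact (inv_mul_le_iff₀ hs).1 this

theorem sum_sq_transpose_mulVec_le {m n : Type*} [Fintype m] [Fintype n]
    (V : Matrix m n ℝ) (I : Finset m) {M : ℝ} (hM : 0 ≤ M)
    (h : ∀ c : n → ℝ, ∑ k, c k ^ 2 = 1 → ∑ i ∈ I, (V *ᵥ c) i ^ 2 ≤ M)
    {x : m → ℝ} (hx : ∑ i, x i ^ 2 = 1) (hxI : ∀ i ∉ I, x i = 0) :
    ∑ k, (V.transpose *ᵥ x) k ^ 2 ≤ M := by
  set w := V.transpose *ᵥ x with hw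
  have hs0 : 0 ≤ ∑ k, w k ^ 2 := Finset.sum_nonneg fun k _ => sq_nonneg _
  have hxI2 : ∑ i ∈ I, x i ^ 2 = 1 := by
    rw [← hx]
    exact Finset.sum_subset (Finset.subset_univ _) fun i _ hi => by simp [hxI i hi]
  have hws : ∑ k, w k ^ 2 = ∑ i ∈ I, x i * (V *ᵥ w) i := by
    rw [hw, ← dotProduct_mul_transpose_mulVec_self, ← Matrix.mulVec_mulVec]
    exact (Finset.sum_subset (Finset.subset_univ _) fun i _ hi => by simp [hxI i hi]).symm
  have hcs := Finset.sum_mul_sq_le_sq_mul_sq I x (V *ᵥ w)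
  rw [← hws, hxI2, one_mul] at hcs
  have := hcs.trans (sum_sq_mulVec_le_of_unit_bound V I h w)
  rcases hs0.eq_or_lt with hs | hs
  · exact hs ▸ hM
  · rw [sq] at this
    exact le_of_mul_le_mul_left this hs

theorem exists_card_eq_and_forall_notMem_eq_zero {N K : ℕ} (hKN : K ≤ N) {x : Fin N → ℝ}
    (hx : {i | x i ≠ 0}.ncard ≤ K) :
    ∃ I : Finset (Fin N), I.card = K ∧ ∀ i ∉ I, x i = 0 := by
  obtain ⟨I, hsub, hI⟩ := Finset.exists_superset_card_eq
    (s := Finset.univ.filter fun i => x i ≠ 0) (n := K)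
    (by simpa [← Set.ncard_coe_finset] using hx) (by simpa using hKN)
  exact ⟨I, hI, fun i hi => by_contra fun hne => hi (hsub (by simpa using hne))⟩

theorem exists_mem_sparseUnit_le {N K D : ℕ} (hN : 0 < N) (hK : 0 < K)
    (V : Matrix (Fin N) (Fin D) ℝ) {c : Fin D → ℝ} (hc : ∑ k, c k ^ 2 = 1)
    {I : Finset (Fin N)} (hI : I.card = K) :
    ∃ x ∈ sparseUnit N K,
      ∑ i ∈ I, (V *ᵥ c) i ^ 2 ≤ ∑ k, (V.transpose *ᵥ x) k ^ 2 := by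
  have hM0 : 0 ≤ ∑ i ∈ I, (V *ᵥ c) i ^ 2 := Finset.sum_nonneg fun k _ => sq_nonneg _
  set M := ∑ i ∈ I, (V *ᵥ c) i ^ 2 with hM
  rcases hM0.eq_or_lt with h0 | h0
  · refine ⟨Pi.single ⟨0, hN⟩ 1, ⟨by simp [Pi.single_apply, ite_pow], ?_⟩, ?_⟩
    · have : {i | (Pi.single ⟨0, hN⟩ 1 : Fin N → ℝ) i ≠ 0} = {⟨0, hN⟩} := by
        ext i; simp [Pi.single_apply]
      rw [this, Set.ncard_singleton]
      exact hK
    · rw [← h0]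
      exact Finset.sum_nonneg fun k _ => sq_nonneg _
  · have hr : (√M)⁻¹ ^ 2 = M⁻¹ := by rw [inv_pow, sq_sqrt hM0]
    set u : Fin N → ℝ := fun i => if i ∈ I then (V *ᵥ c) i else 0 with hu
    have hu2 : ∑ i, u i ^ 2 = M := by simp [hu, hM, ite_pow]
    have huV : u ⬝ᵥ (V *ᵥ c) = M := by simp [hu, hM, dotProduct, ite_mul, sq]
    refine ⟨(√M)⁻¹ • u, ⟨?_, ?_⟩, ?_⟩
    · simp only [Pi.smul_apply, smul_eq_mul, mul_pow, ← Finset.mul_sum, hr, hu2]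
      rw [inv_mul_cancel₀ h0.ne', sqrt_one]
    · rw [← hI, ← Set.ncard_coe_finset]
      refine Set.ncard_le_ncard (fun i hi => ?_) I.finite_toSet
      by_contra hiI
      exact hi (by simp [hu, show i ∉ I from hiI])
    · simp only [Matrix.mulVec_smul, Pi.smul_apply, smul_eq_mul, mul_pow, ← Finset.mul_sum, hr]
      rw [le_inv_mul_iff₀ h0]
      have hcs := Finset.sum_mul_sq_le_sq_mul_sq Finset.univ (V.transpose *ᵥ u) c
      rw [hc, mul_one] at hcs
      rw [Matrix.dotProduct_mulVec, ← Matrix.mulVec_transpose, dotProduct] at huV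
      rwa [huV, sq] at hcs

theorem stmt5 (N K D : ℕ) (hN : 0 < N) (hK : 0 < K) (hD : 0 < D) (hKN : K ≤ N)
    (V : Matrix (Fin N) (Fin D) ℝ) :
    ∃ M : ℝ,
      IsGreatest ((fun x => x ⬝ᵥ ((V * V.transpose) *ᵥ x)) '' sparseUnit N K) M ∧
      IsGreatest
        {m : ℝ | ∃ c : Fin D → ℝ, (∑ k, c k ^ 2) = 1 ∧
          IsGreatest ((fun I : Finset (Fin N) => ∑ i ∈ I, ((V *ᵥ c) i) ^ 2) ''
            {I : Finset (Fin N) | I.card = K}) m} M := by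
  obtain ⟨c₀, I₀, hc₀, hI₀, hmax⟩ := exists_max_sum_sq_mulVec hD hKN V
  have hub : ∀ x ∈ sparseUnit N K,
      ∑ k, (V.transpose *ᵥ x) k ^ 2 ≤ ∑ i ∈ I₀, (V *ᵥ c₀) i ^ 2 := fun x hx => by
    obtain ⟨I, hI, hxI⟩ := exists_card_eq_and_forall_notMem_eq_zero hKN hx.2
    exact sum_sq_transpose_mulVec_le V I (Finset.sum_nonneg fun k _ => sq_nonneg _)
      (fun c hc => hmax c I hc hI) (sqrt_eq_one.1 hx.1) hxI
  refine ⟨∑ i ∈ I₀, (V *ᵥ c₀) i ^ 2, ⟨?_, ?_⟩, ⟨c₀, hc₀, ⟨I₀, hI₀, rfl⟩, ?_⟩, ?_⟩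
  · obtain ⟨x, hx, hle⟩ := exists_mem_sparseUnit_le hN hK V hc₀ hI₀
    exact ⟨x, hx, (dotProduct_mul_transpose_mulVec_self V x).trans ((hub x hx).antisymm hle)⟩
  · rintro _ ⟨x, hx, rfl⟩
    exact (dotProduct_mul_transpose_mulVec_self V x).trans_le (hub x hx)
  · rintro _ ⟨I, hI, rfl⟩
    exact hmax c₀ I hc₀ hI
  · rintro _ ⟨c, hc, ⟨I, hI, rfl⟩, -⟩
    exact hmax c I hc hI
end

section
/- Let N, K, D be positive integers with K ≤ N, let V be an N×D real matrix, let A = VVᵀ, and suppose x* ∈ S_K^N maximizes ‖Vᵀx‖ over S_K^N with Vᵀx* ≠ 0. Then: (a) for every i with x*_i ≠ 0 and every j with x*_j = 0, |(Ax*)_j| ≤ |(Ax*)_i|; and (b) there exists λ > 0 such that x*_i = λ·(Ax*)_i for every i with x*_i ≠ 0. In particular, the support of x* consists of indices of absolutely largest entries of Ax*, and x* is proportional to Ax* on its support. -/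
open Real Set Matrix

/-- A maximizer of `‖Vᵀ y‖` over unit `K`-sparse vectors also maximizes the linear functional
`y ↦ ⟪V Vᵀ x, y⟫` over them. -/
lemma dotProduct_mulVec_le_of_maximizer {N K D : ℕ} (V : Matrix (Fin N) (Fin D) ℝ)
    (x : Fin N → ℝ)
    (hmax : ∀ y ∈ sparseUnit N K,
      Real.sqrt (∑ k, ((V.transpose *ᵥ y) k) ^ 2) ≤
        Real.sqrt (∑ k, ((V.transpose *ᵥ x) k) ^ 2))
    {y : Fin N → ℝ} (hy : y ∈ sparseUnit N K) :
    ((V * V.transpose) *ᵥ x) ⬝ᵥ y ≤ ∑ k, ((V.transpose *ᵥ x) k) ^ 2 := by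
  have hle := (Real.sqrt_le_sqrt_iff (by positivity)).1 (hmax y hy)
  have hdot : ((V * V.transpose) *ᵥ x) ⬝ᵥ y =
      ∑ k, (V.transpose *ᵥ x) k * (V.transpose *ᵥ y) k := by
    rw [← Matrix.mulVec_mulVec, dotProduct_comm, dotProduct_mulVec, ← mulVec_transpose,
      dotProduct_comm]
    rfl
  have hsq : 0 ≤ ∑ k, ((V.transpose *ᵥ x) k - (V.transpose *ᵥ y) k) ^ 2 := by positivity
  simp only [sub_sq, Finset.sum_add_distrib, Finset.sum_sub_distrib, mul_assoc,
    ← Finset.mul_sum] at hsq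
  linarith

/-- Rescaling the bound on a linear functional from unit sparse vectors to all sparse vectors. -/
lemma dotProduct_le_mul_sqrt_of_sparse {N K : ℕ} {g : Fin N → ℝ} {M : ℝ}
    (hg : ∀ y ∈ sparseUnit N K, g ⬝ᵥ y ≤ M) {y : Fin N → ℝ}
    (hy : {i | y i ≠ 0}.ncard ≤ K) : g ⬝ᵥ y ≤ M * Real.sqrt (∑ i, y i ^ 2) := by
  set r := Real.sqrt (∑ i, y i ^ 2) with hr
  have hr2 : r ^ 2 = ∑ i, y i ^ 2 := Real.sq_sqrt (by positivity)
  rcases (Real.sqrt_nonneg (∑ i, y i ^ 2)).eq_or_lt with h0 | hpos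
  · rw [← hr] at h0
    rw [← h0, zero_pow two_ne_zero] at hr2
    have hz : y = 0 := by
      funext i
      simpa using (Finset.sum_eq_zero_iff_of_nonneg (fun i _ => sq_nonneg (y i))).1 hr2.symm i
        (Finset.mem_univ i)
    simp [hz, ← h0]
  · rw [← hr] at hpos
    have hmem : r⁻¹ • y ∈ sparseUnit N K := by
      refine ⟨?_, ?_⟩
      · simp only [Pi.smul_apply, smul_eq_mul, mul_pow, ← Finset.mul_sum, ← hr2]
        rw [← mul_pow, inv_mul_cancel₀ hpos.ne']
        simp
      · simpa [hpos.ne'] using hy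
    have h := hg _ hmem
    rwa [dotProduct_smul, smul_eq_mul, inv_mul_le_iff₀ hpos, mul_comm] at h

/-- If a sparse unit vector maximizes a linear functional over sparse unit vectors, the
functional is proportional to it on its support. -/
lemma eq_mul_of_maximizes_dotProduct {N K : ℕ} {g x : Fin N → ℝ}
    (hx : x ∈ sparseUnit N K) (hg : ∀ y ∈ sparseUnit N K, g ⬝ᵥ y ≤ g ⬝ᵥ x)
    {i : Fin N} (hi : x i ≠ 0) : g i = (g ⬝ᵥ x) * x i := by
  obtain ⟨hnorm, hcard⟩ := hx
  rw [Real.sqrt_eq_one] at hnorm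
  set M := g ⬝ᵥ x with hMdef
  let y : Fin N → ℝ := fun i => if x i = 0 then 0 else g i
  have hsub : {i | y i ≠ 0} ⊆ {i | x i ≠ 0} := fun i hi h => hi (by simp [y, h])
  have hle := dotProduct_le_mul_sqrt_of_sparse hg
    ((Set.ncard_le_ncard hsub (Set.toFinite _)).trans hcard)
  have hgy : g ⬝ᵥ y = ∑ i, y i ^ 2 := by
    refine Finset.sum_congr rfl fun i _ => ?_
    by_cases h : x i = 0 <;> simp [y, h, sq]
  have hyx : ∑ i, y i * x i = M := by
    refine Finset.sum_congr rfl fun i _ => ?_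
    by_cases h : x i = 0 <;> simp [y, h]
  have hnonneg : 0 ≤ ∑ i, y i ^ 2 := by positivity
  have hbound : ∑ i, y i ^ 2 ≤ M ^ 2 := by
    rw [hgy] at hle
    have hs := Real.sq_sqrt hnonneg
    nlinarith [Real.sqrt_nonneg (∑ i, y i ^ 2), sq_nonneg (M - Real.sqrt (∑ i, y i ^ 2))]
  have hexp : ∑ i, (y i - M * x i) ^ 2 = ∑ i, y i ^ 2 - M ^ 2 := by
    calc ∑ i, (y i - M * x i) ^ 2
        = ∑ i, (y i ^ 2 - 2 * M * (y i * x i) + M ^ 2 * x i ^ 2) :=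
          Finset.sum_congr rfl fun i _ => by ring
      _ = ∑ i, y i ^ 2 - M ^ 2 := by
          rw [Finset.sum_add_distrib, Finset.sum_sub_distrib, ← Finset.mul_sum,
            ← Finset.mul_sum, hyx, hnorm]
          ring
  have hterm : (y i - M * x i) ^ 2 ≤ ∑ i, (y i - M * x i) ^ 2 :=
    Finset.single_le_sum (f := fun i => (y i - M * x i) ^ 2) (fun i _ => sq_nonneg _)
      (Finset.mem_univ i)
  have hzero : y i - M * x i = 0 := by
    rw [← sq_eq_zero_iff]
    exact le_antisymm (by linarith) (sq_nonneg _)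
  simpa [y, hi, sub_eq_zero] using hzero

/-- If a sparse unit vector maximizes a linear functional over sparse unit vectors, its support
consists of indices of absolutely largest coefficients of the functional. -/
lemma abs_le_abs_of_maximizes_dotProduct {N K : ℕ} {g x : Fin N → ℝ}
    (hx : x ∈ sparseUnit N K) (hg : ∀ y ∈ sparseUnit N K, g ⬝ᵥ y ≤ g ⬝ᵥ x)
    {i j : Fin N} (hi : x i ≠ 0) (hj : x j = 0) : |g j| ≤ |g i| := by
  obtain ⟨hnorm, hcard⟩ := hx
  rw [Real.sqrt_eq_one] at hnorm
  have hij : i ≠ j := fun h => hi (h ▸ hj)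
  have hmove : ∀ s : ℝ, s ^ 2 = 1 → g j * (s * x i) ≤ g i * x i := by
    intro s hs
    let y : Fin N → ℝ := fun k => x k - (if k = i then x i else 0) + (if k = j then s * x i else 0)
    have hyi : y i = 0 := by simp [y, hij]
    have hyj : y j = s * x i := by simp [y, hij.symm, hj]
    have hyk : ∀ k, k ≠ i → k ≠ j → y k = x k := fun k hki hkj => by simp [y, hki, hkj]
    have hmem : y ∈ sparseUnit N K := by
      refine ⟨?_, ?_⟩
      · rw [Real.sqrt_eq_one]
        have hterm : ∀ k, y k ^ 2 = x k ^ 2 - (if k = i then x i ^ 2 else 0)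
            + (if k = j then x i ^ 2 else 0) := by
          intro k
          rcases eq_or_ne k i with rfl | hki
          · simp [hyi, hij]
          rcases eq_or_ne k j with rfl | hkj
          · simp [hyj, hki, hj, mul_pow, hs]
          · simp [hyk k hki hkj, hki, hkj]
        simp [hterm, Finset.sum_add_distrib, Finset.sum_sub_distrib, hnorm]
      · have hsub : {k | y k ≠ 0} ⊆ Equiv.swap i j '' {k | x k ≠ 0} := by
          intro k hk
          rcases eq_or_ne k i with rfl | hki
          · exact absurd hyi hk
          rcases eq_or_ne k j with rfl | hkj
          · exact ⟨i, hi, Equiv.swap_apply_left _ _⟩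
          · refine ⟨k, ?_, Equiv.swap_apply_of_ne_of_ne hki hkj⟩
            rwa [Set.mem_ofPred_eq, hyk k hki hkj] at hk
        refine (Set.ncard_le_ncard hsub (Set.toFinite _)).trans ?_
        rwa [Set.ncard_image_of_injective _ (Equiv.injective _)]
    have h := hg y hmem
    have hdot : g ⬝ᵥ y = g ⬝ᵥ x - g i * x i + g j * (s * x i) := by
      simp [dotProduct, y, mul_add, mul_sub, Finset.sum_add_distrib, Finset.sum_sub_distrib]
    linarith
  have hpos := hmove 1 (by norm_num)
  have hneg := hmove (-1) (by norm_num)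
  have habs : |g j| * |x i| ≤ |g i| * |x i| := by
    rw [← abs_mul, ← abs_mul]
    exact (abs_le.2 ⟨by linarith, by linarith⟩).trans (le_abs_self (g i * x i))
  exact le_of_mul_le_mul_right habs (abs_pos.2 hi)

theorem stmt7 (N K D : ℕ) (hN : 0 < N) (hK : 0 < K) (hD : 0 < D) (hKN : K ≤ N)
    (V : Matrix (Fin N) (Fin D) ℝ)
    (A : Matrix (Fin N) (Fin N) ℝ) (hA : A = V * V.transpose)
    (xs : Fin N → ℝ) (hxs : xs ∈ sparseUnit N K)
    (hmax : ∀ y ∈ sparseUnit N K,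
      Real.sqrt (∑ k, ((V.transpose *ᵥ y) k) ^ 2) ≤
        Real.sqrt (∑ k, ((V.transpose *ᵥ xs) k) ^ 2))
    (hne : V.transpose *ᵥ xs ≠ 0) :
    (∀ i, xs i ≠ 0 → ∀ j, xs j = 0 → |(A *ᵥ xs) j| ≤ |(A *ᵥ xs) i|) ∧
    (∃ l : ℝ, 0 < l ∧ ∀ i, xs i ≠ 0 → xs i = l * (A *ᵥ xs) i) := by
  have hval : (A *ᵥ xs) ⬝ᵥ xs = ∑ k, ((V.transpose *ᵥ xs) k) ^ 2 := by
    rw [hA, ← Matrix.mulVec_mulVec, dotProduct_comm, dotProduct_mulVec, ← mulVec_transpose]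
    simp [dotProduct, sq]
  have hlin : ∀ y ∈ sparseUnit N K, (A *ᵥ xs) ⬝ᵥ y ≤ (A *ᵥ xs) ⬝ᵥ xs := fun y hy => by
    rw [hval, hA]
    exact dotProduct_mulVec_le_of_maximizer V xs hmax hy
  have hpos : 0 < (A *ᵥ xs) ⬝ᵥ xs := by
    rw [hval]
    obtain ⟨k, hk⟩ := Function.ne_iff.1 hne
    exact Finset.sum_pos' (fun k _ => sq_nonneg _) ⟨k, Finset.mem_univ k, sq_pos_of_ne_zero hk⟩
  refine ⟨fun i hi j hj => abs_le_abs_of_maximizes_dotProduct hxs hlin hi hj,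
    ((A *ᵥ xs) ⬝ᵥ xs)⁻¹, inv_pos.2 hpos, fun i hi => ?_⟩
  rw [eq_inv_mul_iff_mul_eq₀ hpos.ne']
  exact (eq_mul_of_maximizes_dotProduct hxs hlin hi).symm
end

section
/- Let N ≥ 2 be an integer and let V be an N×2 real matrix whose rows V_1, …, V_N ∈ ℝ² satisfy V_i ≠ V_j and V_i ≠ -V_j for all i ≠ j. For φ ∈ (-π/2, π/2] let v(φ) = V·(sin φ, cos φ)ᵀ ∈ ℝ^N. Then the set of points { φ ∈ (-π/2, π/2] : there exist i ≠ j with |v_i(φ)| = |v_j(φ)| } has at most 2·C(N,2) = N(N-1) elements. -/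
open Real Set Matrix

/-- A nonzero linear form in `(sin φ, cos φ)` has at most one zero in a half-open interval of
length `π`. -/
theorem eq_of_linear_form_sin_cos_eq_zero {w : Fin 2 → ℝ} (hw : w ≠ 0) {φ ψ : ℝ}
    (hφ : φ ∈ Set.Ioc (-(π / 2)) (π / 2)) (hψ : ψ ∈ Set.Ioc (-(π / 2)) (π / 2))
    (h₁ : w 0 * Real.sin φ + w 1 * Real.cos φ = 0)
    (h₂ : w 0 * Real.sin ψ + w 1 * Real.cos ψ = 0) : φ = ψ := by
  have hsin : Real.sin (φ - ψ) = 0 := by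
    rw [Real.sin_sub]
    by_contra hne
    refine hw (funext (Fin.forall_fin_two.mpr ⟨?_, ?_⟩))
    · refine (mul_eq_zero.mp ?_).resolve_right hne
      linear_combination Real.cos ψ * h₁ - Real.cos φ * h₂
    · refine (mul_eq_zero.mp ?_).resolve_right hne
      linear_combination Real.sin φ * h₂ - Real.sin ψ * h₁
  have h := (Real.sin_eq_zero_iff_of_lt_of_lt (by linarith [hφ.1, hψ.2])
    (by linarith [hφ.2, hψ.1])).mp hsin
  linarith

theorem exists_forall_zero_eq {w : Fin 2 → ℝ} (hw : w ≠ 0) :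
    ∃ ψ : ℝ, ∀ φ ∈ Set.Ioc (-(π / 2)) (π / 2),
      w 0 * Real.sin φ + w 1 * Real.cos φ = 0 → φ = ψ := by
  by_cases h : ∃ ψ ∈ Set.Ioc (-(π / 2)) (π / 2), w 0 * Real.sin ψ + w 1 * Real.cos ψ = 0
  · obtain ⟨ψ, hψ, hz⟩ := h
    exact ⟨ψ, fun φ hφ hφz => eq_of_linear_form_sin_cos_eq_zero hw hφ hψ hφz hz⟩
  · exact ⟨0, fun φ hφ hz => (h ⟨φ, hφ, hz⟩).elim⟩

theorem stmt10 (N : ℕ) (hN : 2 ≤ N) (V : Matrix (Fin N) (Fin 2) ℝ)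
    (hrows : ∀ i j : Fin N, i ≠ j → V i ≠ V j ∧ V i ≠ -V j) :
    ({φ : ℝ | φ ∈ Set.Ioc (-(π / 2)) (π / 2) ∧
        ∃ i j : Fin N, i ≠ j ∧
          |(V *ᵥ ![Real.sin φ, Real.cos φ]) i| =
            |(V *ᵥ ![Real.sin φ, Real.cos φ]) j|}).Finite ∧
    ({φ : ℝ | φ ∈ Set.Ioc (-(π / 2)) (π / 2) ∧
        ∃ i j : Fin N, i ≠ j ∧
          |(V *ᵥ ![Real.sin φ, Real.cos φ]) i| =
            |(V *ᵥ ![Real.sin φ, Real.cos φ]) j|}).ncard ≤ N * (N - 1) := by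
  -- The pair `(i, j)` stands for `V i - V j` if `i < j`, and for `V i + V j` if `j < i`.
  let w : Fin N × Fin N → Fin 2 → ℝ := fun p =>
    if p.1 < p.2 then V p.1 - V p.2 else V p.1 + V p.2
  have hw : ∀ p : Fin N × Fin N, ∃ ψ : ℝ, p.1 ≠ p.2 → ∀ φ ∈ Set.Ioc (-(π / 2)) (π / 2),
      w p 0 * Real.sin φ + w p 1 * Real.cos φ = 0 → φ = ψ := by
    intro p
    by_cases hp : p.1 = p.2
    · exact ⟨0, fun h => (h hp).elim⟩
    · have hne : w p ≠ 0 := by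
        simp only [w]
        split_ifs
        · exact sub_ne_zero.mpr (hrows _ _ hp).1
        · exact fun h => (hrows _ _ hp).2 (eq_neg_of_add_eq_zero_left h)
      obtain ⟨ψ, hψ⟩ := exists_forall_zero_eq hne
      exact ⟨ψ, fun _ => hψ⟩
  choose g hg using hw
  set S := {φ : ℝ | φ ∈ Set.Ioc (-(π / 2)) (π / 2) ∧
        ∃ i j : Fin N, i ≠ j ∧
          |(V *ᵥ ![Real.sin φ, Real.cos φ]) i| =
            |(V *ᵥ ![Real.sin φ, Real.cos φ]) j|}
  have hsub : S ⊆ ((Finset.univ : Finset (Fin N)).offDiag.image g : Finset ℝ) := by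
    rintro φ ⟨hφ, i, j, hij, habs⟩
    wlog hlt : i < j generalizing i j
    · exact this j i hij.symm habs.symm (lt_of_le_of_ne (not_lt.mp hlt) hij.symm)
    simp only [Matrix.mulVec, dotProduct, Fin.sum_univ_two, Matrix.cons_val_zero,
      Matrix.cons_val_one] at habs
    rw [Finset.coe_image]
    rcases abs_eq_abs.mp habs with h | h
    · refine ⟨(i, j), by simpa using hij, (hg (i, j) hij φ hφ ?_).symm⟩
      simp only [w, if_pos hlt, Pi.sub_apply]
      linear_combination h
    · refine ⟨(j, i), by simpa using hij.symm, (hg (j, i) hij.symm φ hφ ?_).symm⟩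
      simp only [w, if_neg hlt.not_gt, Pi.add_apply]
      linear_combination h
  refine ⟨(Finset.finite_toSet _).subset hsub, ?_⟩
  calc S.ncard ≤ ((Finset.univ : Finset (Fin N)).offDiag.image g).card := by
        rw [← Set.ncard_coe_finset]
        exact Set.ncard_le_ncard hsub (Finset.finite_toSet _)
    _ ≤ (Finset.univ : Finset (Fin N)).offDiag.card := Finset.card_image_le
    _ = N * (N - 1) := by
        rw [Finset.offDiag_card, Finset.card_univ, Fintype.card_fin, Nat.mul_sub_one]
end

section
/- Let N ≥ 2 and 1 ≤ K ≤ N be integers, and let V be an N×2 real matrix whose rows satisfy V_i ≠ V_j and V_i ≠ -V_j for all i ≠ j. For φ ∈ (-π/2, π/2] let v(φ) = V·(sin φ, cos φ)ᵀ ∈ ℝ^N. Call a K-element subset I of {1,…,N} a strict top-K set if there exists φ ∈ (-π/2, π/2] with min_{i∈I} |v_i(φ)| > max_{j∉I} |v_j(φ)|. Then the number of distinct strict top-K sets is at most N(N-1). -/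
open Real Set Matrix

/-- The vector `V · (sin φ, cos φ)ᵀ`. -/
noncomputable def polarVec {N : ℕ} (V : Matrix (Fin N) (Fin 2) ℝ) (φ : ℝ) : Fin N → ℝ :=
  V *ᵥ ![Real.sin φ, Real.cos φ]

/-- The index set `I` strictly dominates its complement at the angle `φ`. -/
def IsStrictTop {N : ℕ} (V : Matrix (Fin N) (Fin 2) ℝ) (I : Finset (Fin N)) (φ : ℝ) : Prop :=
  ∀ i ∈ I, ∀ j ∉ I, |polarVec V φ j| < |polarVec V φ i|

/-- Each unordered pair of rows contributes its difference and its sum, told apart by the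
order of the indices. -/
def rowCombination {N : ℕ} (V : Matrix (Fin N) (Fin 2) ℝ) (e : Fin N × Fin N) : Fin 2 → ℝ :=
  if e.1 < e.2 then V e.1 - V e.2 else V e.1 + V e.2

section

variable {N : ℕ} {V : Matrix (Fin N) (Fin 2) ℝ} {I J : Finset (Fin N)}

theorem polarVec_apply (φ : ℝ) (i : Fin N) :
    polarVec V φ i = V i 0 * Real.sin φ + V i 1 * Real.cos φ := by
  simp [polarVec, Matrix.mulVec, dotProduct, Fin.sum_univ_two]

theorem continuous_abs_polarVec (i : Fin N) : Continuous fun φ => |polarVec V φ i| := by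
  simp only [polarVec_apply]
  fun_prop

theorem abs_polarVec_add_int_mul_pi (φ : ℝ) (n : ℤ) (i : Fin N) :
    |polarVec V (φ + n * π) i| = |polarVec V φ i| := by
  have h : polarVec V (φ + n * π) i = (-1) ^ n * polarVec V φ i := by
    rw [polarVec_apply, polarVec_apply, Real.sin_add_int_mul_pi, Real.cos_add_int_mul_pi]
    ring
  rw [h, abs_mul, abs_zpow, abs_neg, abs_one, _root_.one_zpow, one_mul]

theorem isStrictTop_add_int_mul_pi (φ : ℝ) (n : ℤ) :
    IsStrictTop V I (φ + n * π) ↔ IsStrictTop V I φ := by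
  simp only [IsStrictTop, abs_polarVec_add_int_mul_pi]

theorem isOpen_setOf_isStrictTop : IsOpen {φ | IsStrictTop V I φ} := by
  simp only [IsStrictTop, ofPred_forall]
  exact isOpen_iInter_of_finite fun i => isOpen_iInter_of_finite fun _ =>
    isOpen_iInter_of_finite fun j => isOpen_iInter_of_finite fun _ =>
      isOpen_lt (continuous_abs_polarVec j) (continuous_abs_polarVec i)

theorem IsStrictTop.eq_of_card_eq {φ : ℝ} (hI : IsStrictTop V I φ) (hJ : IsStrictTop V J φ)
    (h : I.card = J.card) : I = J := by
  by_contra hne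
  have h₁ : ¬ I ⊆ J := fun hs => hne (Finset.eq_of_subset_of_card_le hs h.ge)
  have h₂ : ¬ J ⊆ I := fun hs => hne (Finset.eq_of_subset_of_card_le hs h.le).symm
  obtain ⟨i, hiI, hiJ⟩ := Finset.not_subset.mp h₁
  obtain ⟨j, hjJ, hjI⟩ := Finset.not_subset.mp h₂
  exact lt_asymm (hI i hiI j hjI) (hJ j hjJ i hiJ)

/-- An open set of reals containing `b` but missing a point below `b` has a left endpoint. -/
theorem exists_notMem_eventually_mem_nhdsGT {U : Set ℝ} (hU : IsOpen U) {a b : ℝ} (hab : a ≤ b)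
    (ha : a ∉ U) (hb : b ∈ U) : ∃ θ ∉ U, ∀ᶠ t in nhdsWithin θ (Ioi θ), t ∈ U := by
  have hbdd : BddAbove (Uᶜ ∩ Iic b) := ⟨b, fun _ hx => hx.2⟩
  have hmem : sSup (Uᶜ ∩ Iic b) ∈ Uᶜ ∩ Iic b :=
    (hU.isClosed_compl.inter isClosed_Iic).csSup_mem ⟨a, ha, hab⟩ hbdd
  have hlt : sSup (Uᶜ ∩ Iic b) < b :=
    lt_of_le_of_ne hmem.2 fun h => hmem.1 (h.symm ▸ hb)
  refine ⟨_, hmem.1, ?_⟩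
  filter_upwards [Ioo_mem_nhdsGT hlt] with t ht
  by_contra htU
  exact (le_csSup hbdd ⟨htU, ht.2.le⟩).not_gt ht.1

theorem exists_isStrictTop_left_endpoint {φ x : ℝ} (hφ : IsStrictTop V I φ)
    (hx : ¬ IsStrictTop V I x) :
    ∃ θ, ¬ IsStrictTop V I θ ∧ ∀ᶠ t in nhdsWithin θ (Ioi θ), IsStrictTop V I t := by
  obtain ⟨n, hn⟩ := exists_nat_ge ((x - φ) / π)
  have hle : x + ((-n : ℤ) : ℝ) * π ≤ φ := by
    rw [div_le_iff₀ Real.pi_pos] at hn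
    push_cast
    linarith
  exact exists_notMem_eventually_mem_nhdsGT (U := {φ | IsStrictTop V I φ})
    isOpen_setOf_isStrictTop hle (fun h => hx ((isStrictTop_add_int_mul_pi x _).mp h)) hφ

theorem exists_rowCombination_eq_zero {θ : ℝ} (hθ : ¬ IsStrictTop V I θ)
    (h : ∀ᶠ t in nhdsWithin θ (Ioi θ), IsStrictTop V I t) :
    ∃ e : Fin N × Fin N, e.1 ≠ e.2 ∧
      rowCombination V e 0 * Real.sin θ + rowCombination V e 1 * Real.cos θ = 0 := by
  simp only [IsStrictTop, not_forall, not_lt] at hθ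
  obtain ⟨i, hi, j, hj, hij⟩ := hθ
  have hji : |polarVec V θ j| ≤ |polarVec V θ i| :=
    le_of_tendsto_of_tendsto ((continuous_abs_polarVec j).continuousWithinAt (s := Ioi θ))
      ((continuous_abs_polarVec i).continuousWithinAt (s := Ioi θ))
      (h.mono fun t ht => (ht i hi j hj).le)
  have hne : i ≠ j := fun h => hj (h ▸ hi)
  have habs := abs_eq_abs.mp (hij.antisymm hji)
  simp only [polarVec_apply] at habs
  rcases lt_or_gt_of_ne hne with hlt | hlt <;> rcases habs with h | h
  · refine ⟨(i, j), hne, ?_⟩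
    simp only [rowCombination, hlt, if_true, Pi.sub_apply]
    linarith
  · refine ⟨(j, i), hne.symm, ?_⟩
    simp only [rowCombination, hlt.not_gt, if_false, Pi.add_apply]
    linarith
  · refine ⟨(j, i), hne.symm, ?_⟩
    simp only [rowCombination, hlt, if_true, Pi.sub_apply]
    linarith
  · refine ⟨(i, j), hne, ?_⟩
    simp only [rowCombination, hlt.not_gt, if_false, Pi.add_apply]
    linarith

theorem rowCombination_ne_zero
    (hrows : ∀ i j : Fin N, i ≠ j → V i ≠ V j ∧ V i ≠ -V j) {e : Fin N × Fin N}
    (he : e.1 ≠ e.2) : rowCombination V e ≠ 0 := by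
  unfold rowCombination
  split_ifs
  · exact sub_ne_zero.mpr (hrows _ _ he).1
  · exact fun h => (hrows _ _ he).2 (eq_neg_of_add_eq_zero_left h)

/-- A nonzero vector of the plane is orthogonal to only one polar direction. -/
theorem exists_eq_add_int_mul_pi {w : Fin 2 → ℝ} (hw : w ≠ 0) {θ ψ : ℝ}
    (hθ : w 0 * Real.sin θ + w 1 * Real.cos θ = 0)
    (hψ : w 0 * Real.sin ψ + w 1 * Real.cos ψ = 0) : ∃ n : ℤ, θ = ψ + n * π := by
  have h0 : w 0 * Real.sin (θ - ψ) = 0 := by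
    rw [Real.sin_sub]
    linear_combination Real.cos ψ * hθ - Real.cos θ * hψ
  have h1 : w 1 * Real.sin (θ - ψ) = 0 := by
    rw [Real.sin_sub]
    linear_combination Real.sin θ * hψ - Real.sin ψ * hθ
  have hsin : Real.sin (θ - ψ) = 0 := by
    by_contra hs
    refine hw (funext fun k => ?_)
    fin_cases k
    · exact (mul_eq_zero.mp h0).resolve_right hs
    · exact (mul_eq_zero.mp h1).resolve_right hs
  obtain ⟨n, hn⟩ := Real.sin_eq_zero_iff.mp hsin
  exact ⟨n, by linarith⟩

theorem eq_of_eventually_isStrictTop {θ ψ : ℝ} {n : ℤ} (hθ : θ = ψ + n * π)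
    (hI : ∀ᶠ t in nhdsWithin θ (Ioi θ), IsStrictTop V I t)
    (hJ : ∀ᶠ t in nhdsWithin ψ (Ioi ψ), IsStrictTop V J t) (h : I.card = J.card) : I = J := by
  obtain ⟨a, ha, hIa⟩ := mem_nhdsGT_iff_exists_Ioo_subset.mp hI
  obtain ⟨b, hb, hJb⟩ := mem_nhdsGT_iff_exists_Ioo_subset.mp hJ
  rw [mem_Ioi] at ha hb
  obtain ⟨t, hψt, ht⟩ := exists_between (lt_min hb (show ψ < a - n * π by linarith))
  have hJt : IsStrictTop V J t := hJb ⟨hψt, ht.trans_le (min_le_left _ _)⟩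
  have hIt : IsStrictTop V I (t + n * π) :=
    hIa ⟨by linarith, by linarith [ht.trans_le (min_le_right _ _)]⟩
  exact ((isStrictTop_add_int_mul_pi t n).mp hIt).eq_of_card_eq hJt h

end

theorem stmt11 (N K : ℕ) (hN : 2 ≤ N) (hK : 1 ≤ K) (hKN : K ≤ N)
    (V : Matrix (Fin N) (Fin 2) ℝ)
    (hrows : ∀ i j : Fin N, i ≠ j → V i ≠ V j ∧ V i ≠ -V j) :
    ({I : Finset (Fin N) | I.card = K ∧
        ∃ φ ∈ Set.Ioc (-(π / 2)) (π / 2), ∀ i ∈ I, ∀ j ∉ I,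
          |(V *ᵥ ![Real.sin φ, Real.cos φ]) j| <
            |(V *ᵥ ![Real.sin φ, Real.cos φ]) i|}).ncard ≤ N * (N - 1) := by
  change ({I : Finset (Fin N) | I.card = K ∧
    ∃ φ ∈ Set.Ioc (-(π / 2)) (π / 2), IsStrictTop V I φ}).ncard ≤ N * (N - 1)
  set S := {I : Finset (Fin N) | I.card = K ∧
    ∃ φ ∈ Set.Ioc (-(π / 2)) (π / 2), IsStrictTop V I φ}
  by_cases hall : ∃ I ∈ S, ∀ φ, IsStrictTop V I φ
  · obtain ⟨I, hIS, hI⟩ := hall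
    have hS : S ⊆ {I} := by
      rintro J ⟨hJ, φ, -, hφ⟩
      exact hφ.eq_of_card_eq (hI φ) (hJ.trans hIS.1.symm)
    calc S.ncard ≤ ({I} : Set (Finset (Fin N))).ncard := ncard_le_ncard hS
      _ = 1 := ncard_singleton I
      _ ≤ N * (N - 1) := Nat.mul_pos (by omega) (by omega)
  · push Not at hall
    have hend : ∀ I ∈ S, ∃ (e : Fin N × Fin N) (θ : ℝ), e.1 ≠ e.2 ∧
        rowCombination V e 0 * Real.sin θ + rowCombination V e 1 * Real.cos θ = 0 ∧
        ∀ᶠ t in nhdsWithin θ (Ioi θ), IsStrictTop V I t := by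
      intro I hI
      obtain ⟨x, hx⟩ := hall I hI
      obtain ⟨-, φ, -, hφ⟩ := hI
      obtain ⟨θ, hθ, hev⟩ := exists_isStrictTop_left_endpoint hφ hx
      obtain ⟨e, he, hzero⟩ := exists_rowCombination_eq_zero hθ hev
      exact ⟨e, θ, he, hzero, hev⟩
    have : Nonempty (Fin N × Fin N) := ⟨⟨0, by omega⟩, ⟨0, by omega⟩⟩
    choose! e θ hne hzero hev using hend
    calc S.ncard ≤ (((Finset.univ : Finset (Fin N)).offDiag : Finset (Fin N × Fin N)) :
          Set (Fin N × Fin N)).ncard := by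
          refine ncard_le_ncard_of_injOn e (fun I hI => by simpa using hne I hI) ?_
          intro I hI J hJ hIJ
          obtain ⟨n, hn⟩ := exists_eq_add_int_mul_pi (rowCombination_ne_zero hrows (hne I hI))
            (hzero I hI) (hIJ ▸ hzero J hJ)
          exact eq_of_eventually_isStrictTop hn (hev I hI) (hev J hJ) (hI.1.trans hJ.1.symm)
      _ = N * (N - 1) := by
          rw [ncard_coe_finset, Finset.offDiag_card, Finset.card_fin, Nat.mul_sub_one]
end

section
/- Let N, K, D be integers with D ≥ 2, D ≤ N and 1 ≤ K ≤ N, and let V be an N×D real matrix. Call a K-element subset I of {1,…,N} a strict top-K set if there exists a unit vector c ∈ ℝ^D with min_{i∈I} |(Vc)_i| > max_{j∉I} |(Vc)_j|. Assume V is in general position in the following sense: for every integer m with 2 ≤ m ≤ D and m ≡ D (mod 2), for every choice of m distinct indices i_1 < i_2 < … < i_m in {1,…,N} and every choice of signs s_2, …, s_m ∈ {+1, -1}, the (m-1)×m matrix whose r-th row is the restriction of V_{i_1} - s_{r+1} V_{i_{r+1}} to the first m columns has rank m-1. Then the number of distinct strict top-K sets is at most Σ_{d=0}^{⌊(D-1)/2⌋}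 C(N, D-2d) · C(D-2d, ⌊D/2⌋ - d) · 2^{D-1-2d}. -/
open Real Set Matrix

/-- A nonempty region cut out by conditions `0 ≤ φ l ((V *ᵥ c) l)`, each of which can be violated,
has a vertex when `V` is injective. -/
theorem exists_vertex {N D : ℕ} (V : Matrix (Fin N) (Fin D) ℝ)
    (hV : ∀ u, V *ᵥ u = 0 → u = 0) (φ : Fin N → ℝ → ℝ) (hφ : ∀ l, Continuous (φ l))
    (hneg : ∀ l, ∃ y, φ l y < 0) (hne : ∃ c, ∀ l, 0 ≤ φ l ((V *ᵥ c) l)) :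
    ∃ c, (∀ l, 0 ≤ φ l ((V *ᵥ c) l)) ∧
      ∀ u, (∀ l, φ l ((V *ᵥ c) l) = 0 → (V *ᵥ u) l = 0) → u = 0 := by
  classical
  let tight : (Fin D → ℝ) → Finset (Fin N) := fun c => {l | φ l ((V *ᵥ c) l) = 0}
  let S : Set (Finset (Fin N)) := tight '' {c | ∀ l, 0 ≤ φ l ((V *ᵥ c) l)}
  obtain ⟨c₀, hc₀⟩ := hne
  obtain ⟨T, ⟨c, hc, rfl⟩, hmax⟩ := (Set.toFinite S).exists_maximal ⟨_, c₀, hc₀, rfl⟩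
  refine ⟨c, hc, fun u hu => by_contra fun hu0 => ?_⟩
  obtain ⟨l₀, hl₀⟩ : ∃ l, (V *ᵥ u) l ≠ 0 := by
    by_contra! h
    exact hu0 (hV u (funext h))
  have hl₀T : l₀ ∈ (tight c)ᶜ := by
    simp only [tight, Finset.mem_compl, Finset.mem_filter, Finset.mem_univ, true_and]
    exact fun h => hl₀ (hu l₀ h)
  let g : ℝ → ℝ := fun τ =>
    (tight c)ᶜ.inf' ⟨l₀, hl₀T⟩ fun l => φ l ((V *ᵥ c) l + τ * (V *ᵥ u) l)
  have hg : Continuous g := by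
    refine Continuous.finset_inf'_apply _ fun l _ => (hφ l).comp (by fun_prop)
  have hg0 : 0 ≤ g 0 := by
    simp only [g, zero_mul, add_zero]
    exact Finset.le_inf' _ _ fun l _ => hc l
  obtain ⟨y, hy⟩ := hneg l₀
  have hg1 : g ((y - (V *ᵥ c) l₀) / (V *ᵥ u) l₀) ≤ 0 := by
    refine (Finset.inf'_le _ hl₀T).trans ?_
    rw [div_mul_cancel₀ _ hl₀]
    simpa using hy.le
  obtain ⟨τ, hτ⟩ := mem_range_of_exists_le_of_exists_ge hg ⟨_, hg1⟩ ⟨_, hg0⟩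
  have hval : ∀ l, (V *ᵥ (c + τ • u)) l = (V *ᵥ c) l + τ * (V *ᵥ u) l := by
    intro l
    simp [Matrix.mulVec_add, Matrix.mulVec_smul]
  have hold : ∀ l ∈ tight c, φ l ((V *ᵥ (c + τ • u)) l) = 0 := by
    intro l hl
    have hl : φ l ((V *ᵥ c) l) = 0 := by simpa [tight] using hl
    rw [hval, hu l hl, mul_zero, add_zero, hl]
  have hfeas : ∀ l, 0 ≤ φ l ((V *ᵥ (c + τ • u)) l) := by
    intro l
    by_cases hl : l ∈ tight c
    · exact (hold l hl).ge
    · rw [hval, ← hτ]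
      exact Finset.inf'_le _ (Finset.mem_compl.2 hl)
  obtain ⟨l₁, hl₁, h₁⟩ := Finset.exists_mem_eq_inf' ⟨l₀, hl₀T⟩
    fun l => φ l ((V *ᵥ c) l + τ * (V *ᵥ u) l)
  have hsub : tight c ≤ tight (c + τ • u) := fun l hl => by
    simpa [tight] using hold l hl
  refine Finset.mem_compl.1 hl₁ (hmax ⟨_, hfeas, rfl⟩ hsub ?_)
  simp only [tight, Finset.mem_filter, Finset.mem_univ, true_and]
  rw [hval, ← h₁]
  exact hτ

/-- A point separating `I` from its complement at thresholds `w` can be moved to a point which is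
determined by the rows attaining their threshold. -/
theorem exists_vertex_of_separating {N D : ℕ} (V : Matrix (Fin N) (Fin D) ℝ)
    (hV : ∀ u, V *ᵥ u = 0 → u = 0) (w : Fin N → ℝ) (hw : ∀ l, 0 < w l) (I : Finset (Fin N))
    (hne : ∃ c, (∀ i ∈ I, w i ≤ |(V *ᵥ c) i|) ∧ ∀ j ∉ I, |(V *ᵥ c) j| ≤ w j) :
    ∃ c, ((∀ i ∈ I, w i ≤ |(V *ᵥ c) i|) ∧ ∀ j ∉ I, |(V *ᵥ c) j| ≤ w j) ∧
      ∀ u, (∀ l, |(V *ᵥ c) l| = w l → (V *ᵥ u) l = 0) → u = 0 := by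
  classical
  obtain ⟨c₀, h₁, h₂⟩ := hne
  let s : Fin N → ℝ := fun l => if 0 ≤ (V *ᵥ c₀) l then 1 else -1
  have hs : ∀ l x, s l * x ≤ |x| := by
    intro l x
    by_cases h : 0 ≤ (V *ᵥ c₀) l
    · simpa [s, h] using le_abs_self x
    · simpa [s, h] using neg_le_abs x
  have hs0 : ∀ l, s l * (V *ᵥ c₀) l = |(V *ᵥ c₀) l| := by
    intro l
    by_cases h : 0 ≤ (V *ᵥ c₀) l
    · simp [s, h, abs_of_nonneg h]
    · simp [s, h, abs_of_neg (not_le.1 h)]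
  have hsabs : ∀ l x, |s l * x| = |x| := by
    intro l x
    by_cases h : 0 ≤ (V *ᵥ c₀) l <;> simp [s, h]
  let φ : Fin N → ℝ → ℝ := fun l x => if l ∈ I then s l * x - w l else w l - |x|
  obtain ⟨c, hc, hu⟩ := exists_vertex V hV φ
    (fun l => by by_cases h : l ∈ I <;> simp only [φ, h, if_true, if_false] <;> fun_prop)
    (fun l => by
      by_cases h : l ∈ I
      · exact ⟨0, by simpa [φ, h] using hw l⟩
      · exact ⟨w l + 1, by simp [φ, h, abs_of_pos (add_pos (hw l) one_pos)]⟩)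
    ⟨c₀, fun l => by
      by_cases h : l ∈ I
      · simpa [φ, h, hs0] using h₁ l h
      · simpa [φ, h] using h₂ l h⟩
  refine ⟨c, ⟨fun i hi => ?_, fun j hj => ?_⟩, fun u h => hu u fun l hl => h l ?_⟩
  · have := hc i
    simp only [φ, hi, if_true] at this
    linarith [hs i ((V *ᵥ c) i)]
  · have := hc j
    simp only [φ, hj, if_false] at this
    linarith
  · by_cases hI : l ∈ I
    · simp only [φ, hI, if_true] at hl
      rw [← hsabs, sub_eq_zero.1 hl, abs_of_pos (hw l)]
    · simp only [φ, hI, if_false] at hl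
      linarith

theorem Polynomial.eventually_eval_ne_zero {p : Polynomial ℝ} (hp : p ≠ 0) (x : ℝ) :
    ∀ᶠ ε in nhdsWithin x (Ioi x), p.eval ε ≠ 0 := by
  have hfin : {y | p.IsRoot y}.Finite := Polynomial.finite_setOfPred_isRoot hp
  have h : ({y | p.IsRoot y} \ {x})ᶜ ∈ nhds x :=
    (hfin.subset sdiff_subset).isClosed.isOpen_compl.mem_nhds (by simp)
  filter_upwards [nhdsWithin_le_nhds h, self_mem_nhdsWithin] with y hy hxy h0
  exact hy ⟨h0, (ne_of_gt hxy)⟩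

open Polynomial in
/-- For small generic perturbations of the constant threshold `1`, at most `D` rows of `V` can
attain their threshold simultaneously. -/
theorem eventually_card_tight_le {N D : ℕ} (V : Matrix (Fin N) (Fin D) ℝ) :
    ∀ᶠ ε in nhdsWithin (0 : ℝ) (Ioi 0), ∀ c,
      ({l | |(V *ᵥ c) l| = 1 + ε ^ (l.1 + 1)} : Finset (Fin N)).card ≤ D := by
  classical
  have key : ∀ T : Finset (Fin N), D < T.card → ∀ σ : Fin N → SignType, (∀ l, σ l ≠ 0) →
      ∀ᶠ ε in nhdsWithin (0 : ℝ) (Ioi 0), ∀ c,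
        ¬ ∀ l ∈ T, (V *ᵥ c) l = (σ l : ℝ) * (1 + ε ^ (l.1 + 1)) := by
    intro T hT σ hσ
    have hdep : ¬ LinearIndependent ℝ fun l : T => V l := fun h => by
      have := h.fintype_card_le_finrank
      simp at this
      omega
    obtain ⟨a, ha, l₁, hl₁⟩ := Fintype.not_linearIndependent_iff.1 hdep
    let p : ℝ[X] := ∑ l : T, Polynomial.C (a l * (σ l : ℝ)) * (1 + X ^ (l.1.1 + 1))
    have hp : p ≠ 0 := by
      intro h
      have hcoeff : p.coeff (l₁.1.1 + 1) = a l₁ * (σ l₁ : ℝ) := by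
        simp only [p, Polynomial.finsetSum_coeff, Polynomial.coeff_C_mul, Polynomial.coeff_add,
          Polynomial.coeff_one, Polynomial.coeff_X_pow]
        rw [Finset.sum_eq_single l₁]
        · simp
        · intro b _ hb
          have : (l₁.1 : ℕ) ≠ b.1 := fun h => hb (Subtype.ext (Fin.ext h.symm))
          simp [this]
        · simp
      rw [h, Polynomial.coeff_zero] at hcoeff
      have : (σ l₁ : ℝ) ≠ 0 := by
        rcases SignType.trichotomy (σ l₁) with h | h | h
        · simp [h]
        · exact (hσ _ h).elim
        · simp [h]
      exact mul_ne_zero hl₁ this hcoeff.symm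
    filter_upwards [Polynomial.eventually_eval_ne_zero hp 0] with ε hε c hc
    apply hε
    have h : (∑ l : T, a l • V l) ⬝ᵥ c = 0 := by rw [ha, zero_dotProduct]
    rw [sum_dotProduct] at h
    simp only [p, Polynomial.eval_finsetSum]
    rw [← h]
    refine Finset.sum_congr rfl fun l _ => ?_
    have := hc l l.2
    simp only [mulVec] at this
    rw [smul_dotProduct, this]
    simp [mul_assoc]
  have all : ∀ᶠ ε in nhdsWithin (0 : ℝ) (Ioi 0), ∀ T : Finset (Fin N), ∀ σ : Fin N → SignType,
      D < T.card → (∀ l, σ l ≠ 0) → ∀ c,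
        ¬ ∀ l ∈ T, (V *ᵥ c) l = (σ l : ℝ) * (1 + ε ^ (l.1 + 1)) := by
    rw [Filter.eventually_all]
    intro T
    rw [Filter.eventually_all]
    intro σ
    by_cases h : D < T.card ∧ ∀ l, σ l ≠ 0
    · filter_upwards [key T h.1 σ h.2] with ε hε _ _ using hε
    · exact Filter.Eventually.of_forall fun ε h1 h2 => (h ⟨h1, h2⟩).elim
  filter_upwards [all] with ε hε c
  by_contra! h
  refine hε _ (fun l => if 0 ≤ (V *ᵥ c) l then 1 else -1) h
    (fun l => by split_ifs <;> decide) c fun l hl => ?_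
  have hl : |(V *ᵥ c) l| = 1 + ε ^ (l.1 + 1) := by simpa using hl
  rw [← hl]
  by_cases h0 : 0 ≤ (V *ᵥ c) l
  · simp [h0, abs_of_nonneg h0]
  · simp [h0, abs_of_neg (not_le.1 h0)]

/-- The `K`-element sets of rows on which the entries of some `V *ᵥ c` strictly dominate the other
entries in absolute value. -/
def strictTopK {N D : ℕ} (V : Matrix (Fin N) (Fin D) ℝ) (K : ℕ) : Set (Finset (Fin N)) :=
  {I | I.card = K ∧ ∃ c, ∀ i ∈ I, ∀ j ∉ I, |(V *ᵥ c) j| < |(V *ᵥ c) i|}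

theorem card_le_of_vertices {N D : ℕ} (hD : 1 ≤ D) (V : Matrix (Fin N) (Fin D) ℝ)
    (w : Fin N → ℝ) (hw : ∀ l, 0 < w l)
    (htight : ∀ c, ({l | |(V *ᵥ c) l| = w l} : Finset (Fin N)).card ≤ D)
    (K : ℕ) (S : Finset (Finset (Fin N)))
    (hS : ∀ I ∈ S, I.card = K ∧
      ∃ c, ((∀ i ∈ I, w i ≤ |(V *ᵥ c) i|) ∧ ∀ j ∉ I, |(V *ᵥ c) j| ≤ w j) ∧
        ∀ u, (∀ l, |(V *ᵥ c) l| = w l → (V *ᵥ u) l = 0) → u = 0) :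
    S.card ≤ N.choose D * D.choose (D / 2) * 2 ^ (D - 1) := by
  classical
  let tight : (Fin D → ℝ) → Finset (Fin N) := fun c => {l | |(V *ᵥ c) l| = w l}
  have hcard : ∀ c, (∀ u, (∀ l, |(V *ᵥ c) l| = w l → (V *ᵥ u) l = 0) → u = 0) →
      (tight c).card = D := by
    intro c hc
    refine (htight c).antisymm ?_
    let f : (Fin D → ℝ) →ₗ[ℝ] (tight c → ℝ) :=
      (LinearMap.funLeft ℝ ℝ (Subtype.val : tight c → Fin N)) ∘ₗ V.mulVecLin
    have hf : Function.Injective f := by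
      rw [injective_iff_map_eq_zero]
      refine fun u hu => hc u fun l hl => ?_
      exact congrFun hu ⟨l, by simpa [tight] using hl⟩
    simpa using LinearMap.finrank_le_finrank_of_injective hf
  have hbase : ∀ T : Finset (Fin N), ∃ m : Option (Fin N), T.Nonempty → ∃ x ∈ T, m = some x := by
    intro T
    by_cases h : T.Nonempty
    · exact ⟨some h.choose, fun _ => ⟨_, h.choose_spec, rfl⟩⟩
    · exact ⟨none, fun h' => (h h').elim⟩
  choose base hbase using hbase
  have hnorm : ∀ I : Finset (Fin N), ∃ c, I ∈ S → (I.card = K ∧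
      ((∀ i ∈ I, w i ≤ |(V *ᵥ c) i|) ∧ ∀ j ∉ I, |(V *ᵥ c) j| ≤ w j) ∧
      (∀ u, (∀ l, |(V *ᵥ c) l| = w l → (V *ᵥ u) l = 0) → u = 0) ∧
      ∃ x ∈ tight c, base (tight c) = some x ∧ 0 < (V *ᵥ c) x) := by
    intro I
    by_cases hI : I ∈ S
    swap
    · exact ⟨0, fun h => (hI h).elim⟩
    obtain ⟨hK, c, hc, hu⟩ := hS I hI
    obtain ⟨x, hx, hbx⟩ := hbase (tight c) (Finset.card_pos.1 (by have := hcard c hu; omega))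
    have hxw : |(V *ᵥ c) x| = w x := by simpa [tight] using hx
    have hx0 : (V *ᵥ c) x ≠ 0 := abs_pos.1 (hxw ▸ hw x)
    rcases hx0.lt_or_gt with h | h
    · have hneg : tight (-c) = tight c := by simp [tight, mulVec_neg]
      refine ⟨-c, fun _ => ⟨hK, ?_, ?_, x, hneg ▸ hx, hneg ▸ hbx, ?_⟩⟩
      · simpa [mulVec_neg] using hc
      · simpa [mulVec_neg] using hu
      · simpa [mulVec_neg] using h
    · exact ⟨c, fun _ => ⟨hK, hc, hu, x, hx, hbx, h⟩⟩
  choose c hc using hnorm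
  let code : Finset (Fin N) → (_ : Finset (Fin N)) × Finset (Fin N) := fun I =>
    ⟨tight (c I), {l ∈ tight (c I) | 0 < (V *ᵥ c I) l ∧ base (tight (c I)) ≠ some l}⟩
  have hdet : ∀ I ∈ S, ∀ J ∈ S, code I = code J → c I = c J := by
    intro I hI J hJ h
    obtain ⟨-, -, hu, x, hx, hbx, hxI⟩ := hc I hI
    obtain ⟨-, -, -, y, hy, hby, hyJ⟩ := hc J hJ
    simp only [code, Sigma.mk.injEq, heq_eq_eq] at h
    obtain ⟨hT, hP⟩ := h
    have hxy : x = y := by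
      rw [hT, hby] at hbx
      exact (Option.some.inj hbx).symm
    subst hxy
    refine sub_eq_zero.1 (hu _ fun l hl => ?_)
    rw [mulVec_sub, Pi.sub_apply, sub_eq_zero]
    have hlT : l ∈ tight (c I) := by simpa [tight] using hl
    have hlT' : l ∈ tight (c J) := hT ▸ hlT
    have hl' : |(V *ᵥ c J) l| = w l := by simpa [tight] using hlT'
    have hsign : 0 < (V *ᵥ c I) l ↔ 0 < (V *ᵥ c J) l := by
      by_cases hlx : l = x
      · subst hlx
        exact iff_of_true hxI hyJ
      · have := Finset.ext_iff.1 hP l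
        rw [hT] at hlT
        simpa [hT, hlT, hby, Ne.symm hlx] using this
    rcases abs_eq_abs.1 (hl.trans hl'.symm) with h | h
    · exact h
    · have hwl := hw l
      rw [← hl', abs_pos] at hwl
      rcases hwl.lt_or_gt with h0 | h0
      · exact (lt_asymm h0 (hsign.1 (by linarith))).elim
      · linarith [hsign.2 h0]
  have hfiber : ∀ b ∈ S.image code, (S.filter fun I => code I = b).card ≤ D.choose (D / 2) := by
    intro b hb
    obtain ⟨J, hJ, rfl⟩ := Finset.mem_image.1 hb
    let big : Finset (Fin N) := {l | w l < |(V *ᵥ c J) l|}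
    have hmem : ∀ I ∈ S, c I = c J → I \ tight (c J) = big := by
      intro I hI hIJ
      obtain ⟨-, ⟨h1, h2⟩, -⟩ := hc I hI
      rw [hIJ] at h1 h2
      ext l
      simp only [tight, big, Finset.mem_sdiff, Finset.mem_filter, Finset.mem_univ, true_and]
      constructor
      · rintro ⟨hl, hne⟩
        exact (h1 l hl).lt_of_ne (Ne.symm hne)
      · exact fun hl => ⟨by_contra fun h => (h2 l h).not_gt hl, hl.ne'⟩
    calc (S.filter fun I => code I = code J).card
        ≤ (Finset.powersetCard (K - big.card) (tight (c J))).card := by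
          refine Finset.card_le_card_of_injOn (fun I => I ∩ tight (c J)) ?_ ?_
          · intro I hI
            obtain ⟨hI, hIJ⟩ := Finset.mem_filter.1 hI
            have h1 := hmem I hI (hdet I hI J hJ hIJ)
            have h2 := Finset.card_inter_add_card_sdiff I (tight (c J))
            rw [h1, (hc I hI).1] at h2
            exact Finset.mem_powersetCard.2 ⟨Finset.inter_subset_right, by dsimp only; omega⟩
          · intro I hI I' hI' h
            obtain ⟨hI, hIJ⟩ := Finset.mem_filter.1 hI
            obtain ⟨hI', hIJ'⟩ := Finset.mem_filter.1 hI'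
            dsimp only at h
            rw [← Finset.sdiff_union_inter I (tight (c J)),
              ← Finset.sdiff_union_inter I' (tight (c J)), h,
              hmem I hI (hdet I hI J hJ hIJ), hmem I' hI' (hdet I' hI' J hJ hIJ')]
      _ = D.choose (K - big.card) := by
          rw [Finset.card_powersetCard, hcard _ (hc J hJ).2.2.1]
      _ ≤ D.choose (D / 2) := Nat.choose_le_middle _ _
  have himage : (S.image code).card ≤ N.choose D * 2 ^ (D - 1) := by
    calc (S.image code).card
        ≤ ((Finset.powersetCard D Finset.univ).sigma fun T : Finset (Fin N) =>
            (T.filter fun l => base T ≠ some l).powerset).card := by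
          refine Finset.card_le_card fun b hb => ?_
          obtain ⟨I, hI, rfl⟩ := Finset.mem_image.1 hb
          simp only [code, Finset.mem_sigma, Finset.mem_powersetCard, Finset.subset_univ, true_and,
            Finset.mem_powerset]
          refine ⟨hcard _ (hc I hI).2.2.1, fun l hl => ?_⟩
          simp only [Finset.mem_filter] at hl ⊢
          exact ⟨hl.1, hl.2.2⟩
      _ = ∑ T ∈ Finset.powersetCard D (Finset.univ : Finset (Fin N)), 2 ^ (D - 1) := by
          rw [Finset.card_sigma]
          refine Finset.sum_congr rfl fun T hT => ?_
          obtain ⟨-, hT⟩ := Finset.mem_powersetCard.1 hT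
          obtain ⟨x, hx, hbx⟩ := hbase T (Finset.card_pos.1 (by omega))
          have : (T.filter fun l => base T ≠ some l) = T.erase x := by
            ext l
            simp [hbx, Finset.mem_erase, and_comm, eq_comm]
          rw [Finset.card_powerset, this, Finset.card_erase_of_mem hx, hT]
      _ = N.choose D * 2 ^ (D - 1) := by simp
  calc S.card ≤ D.choose (D / 2) * (S.image code).card :=
        Finset.card_le_mul_card_image _ _ hfiber
    _ ≤ D.choose (D / 2) * (N.choose D * 2 ^ (D - 1)) := Nat.mul_le_mul_left _ himage
    _ = _ := by ring

theorem exists_separating_one {N D : ℕ} {V : Matrix (Fin N) (Fin D) ℝ} {I : Finset (Fin N)}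
    (hI : I.Nonempty) (hI' : Iᶜ.Nonempty)
    (h : ∃ c, ∀ i ∈ I, ∀ j ∉ I, |(V *ᵥ c) j| < |(V *ᵥ c) i|) :
    ∃ c, (∀ i ∈ I, 1 < |(V *ᵥ c) i|) ∧ ∀ j ∉ I, |(V *ᵥ c) j| < 1 := by
  obtain ⟨c, hc⟩ := h
  obtain ⟨i₀, hi₀, hmin⟩ := I.exists_min_image (fun i => |(V *ᵥ c) i|) hI
  obtain ⟨j₀, hj₀, hmax⟩ := Iᶜ.exists_max_image (fun i => |(V *ᵥ c) i|) hI'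
  obtain ⟨t, ht₁, ht₂⟩ := exists_between (hc i₀ hi₀ j₀ (Finset.mem_compl.1 hj₀))
  have ht : 0 < t := (abs_nonneg _).trans_lt ht₁
  have hval : ∀ l, |(V *ᵥ (t⁻¹ • c)) l| = |(V *ᵥ c) l| / t := by
    intro l
    rw [mulVec_smul, Pi.smul_apply, smul_eq_mul, abs_mul, abs_inv, abs_of_pos ht, div_eq_inv_mul]
  refine ⟨t⁻¹ • c, fun i hi => ?_, fun j hj => ?_⟩
  · rw [hval, one_lt_div ht]
    exact ht₂.trans_le (hmin i hi)
  · rw [hval, div_lt_one ht]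
    exact (hmax j (Finset.mem_compl.2 hj)).trans_lt ht₁

theorem ncard_strictTopK_le_of_injective {N D K : ℕ} (hD : 1 ≤ D) (hK : 1 ≤ K) (hKN : K < N)
    (V : Matrix (Fin N) (Fin D) ℝ) (hV : ∀ u, V *ᵥ u = 0 → u = 0) :
    (strictTopK V K).ncard ≤ N.choose D * D.choose (D / 2) * 2 ^ (D - 1) := by
  classical
  have hsep : ∀ᶠ ε in nhdsWithin (0 : ℝ) (Ioi 0), ∀ I : Finset (Fin N), I ∈ strictTopK V K →
      ∃ c, (∀ i ∈ I, 1 + ε ^ (i.1 + 1) ≤ |(V *ᵥ c) i|) ∧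
        ∀ j ∉ I, |(V *ᵥ c) j| ≤ 1 + ε ^ (j.1 + 1) := by
    rw [Filter.eventually_all]
    intro I
    by_cases hI : I ∈ strictTopK V K
    swap
    · exact Filter.Eventually.of_forall fun _ h => (hI h).elim
    obtain ⟨c, h1, h2⟩ := exists_separating_one
      (Finset.card_pos.1 (by have := hI.1; omega))
      (Finset.card_pos.1 (by have := hI.1; rw [Finset.card_compl, Fintype.card_fin]; omega)) hI.2
    have hlim : ∀ᶠ ε in nhdsWithin (0 : ℝ) (Ioi 0), ∀ i, i ∈ I →
        1 + ε ^ (i.1 + 1) < |(V *ᵥ c) i| := by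
      rw [Filter.eventually_all]
      intro i
      by_cases hi : i ∈ I
      swap
      · exact Filter.Eventually.of_forall fun _ h => (hi h).elim
      have hcont : ContinuousAt (fun ε : ℝ => 1 + ε ^ (i.1 + 1)) 0 := by fun_prop
      filter_upwards [nhdsWithin_le_nhds (hcont.eventually_lt_const (by simpa using h1 i hi))]
        with ε hε _ using hε
    filter_upwards [hlim, self_mem_nhdsWithin] with ε hε hpos _
    refine ⟨c, fun i hi => (hε i hi).le, fun j hj => (h2 j hj).le.trans ?_⟩
    have : (0 : ℝ) < ε ^ (j.1 + 1) := pow_pos hpos _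
    linarith
  obtain ⟨ε, ⟨hε, hgen⟩, hpos⟩ :=
    ((hsep.and (eventually_card_tight_le V)).and self_mem_nhdsWithin).exists
  have hw : ∀ l : Fin N, 0 < 1 + ε ^ (l.1 + 1) := fun l => by
    have : (0 : ℝ) < ε ^ (l.1 + 1) := pow_pos hpos _
    linarith
  rw [Set.ncard_eq_toFinset_card _ (Set.toFinite _)]
  refine card_le_of_vertices hD V _ hw hgen K _ fun I hI => ?_
  have hI : I ∈ strictTopK V K := by simpa using hI
  exact ⟨hI.1, exists_vertex_of_separating V hV _ hw I (hε I hI)⟩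

theorem eventually_injective_add_smul {N D : ℕ} (hDN : D ≤ N) (V : Matrix (Fin N) (Fin D) ℝ) :
    ∀ᶠ ε in nhdsWithin (0 : ℝ) (Ioi 0), ∀ u,
      (V + ε • Matrix.of fun (i : Fin N) (k : Fin D) => if i.1 = k.1 then (1 : ℝ) else 0) *ᵥ u = 0 →
        u = 0 := by
  let A : Matrix (Fin D) (Fin D) ℝ := V.submatrix (Fin.castLE hDN) id
  filter_upwards [Polynomial.eventually_eval_ne_zero (Matrix.charpoly_monic (-A)).ne_zero 0]
    with ε hε u hu
  rw [Matrix.eval_charpoly] at hε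
  refine Matrix.eq_zero_of_mulVec_eq_zero hε ?_
  ext i
  rw [← show _ = (0 : Fin D → ℝ) i from congrFun hu (Fin.castLE hDN i)]
  simp only [mulVec]
  congr 1
  ext k
  simp [A, Matrix.scalar_apply, Matrix.diagonal_apply, Fin.ext_iff, add_comm]

theorem eventually_strictTopK_subset {N D : ℕ} (V E : Matrix (Fin N) (Fin D) ℝ) (K : ℕ) :
    ∀ᶠ ε in nhdsWithin (0 : ℝ) (Ioi 0), strictTopK V K ⊆ strictTopK (V + ε • E) K := by
  have h : ∀ᶠ ε in nhdsWithin (0 : ℝ) (Ioi 0), ∀ I, I ∈ strictTopK V K →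
      I ∈ strictTopK (V + ε • E) K := by
    rw [Filter.eventually_all]
    intro I
    by_cases hI : I ∈ strictTopK V K
    swap
    · exact Filter.Eventually.of_forall fun _ h => (hI h).elim
    obtain ⟨hK, c, hc⟩ := hI
    have hlim : ∀ᶠ ε in nhdsWithin (0 : ℝ) (Ioi 0), ∀ i j, i ∈ I → j ∉ I →
        |((V + ε • E) *ᵥ c) j| < |((V + ε • E) *ᵥ c) i| := by
      rw [Filter.eventually_all]
      intro i
      rw [Filter.eventually_all]
      intro j
      by_cases hij : i ∈ I ∧ j ∉ I
      swap
      · exact Filter.Eventually.of_forall fun _ hi hj => (hij ⟨hi, hj⟩).elim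
      have hcont : ∀ l, ContinuousAt (fun ε : ℝ => |((V + ε • E) *ᵥ c) l|) 0 := by
        intro l
        simp only [add_mulVec, smul_mulVec, Pi.add_apply, Pi.smul_apply]
        fun_prop
      filter_upwards [nhdsWithin_le_nhds ((hcont j).eventually_lt (hcont i)
        (by simpa using hc i hij.1 j hij.2))] with ε hε _ _ using hε
    filter_upwards [hlim] with ε hε _
    exact ⟨hK, c, fun i hi j hj => hε i j hi hj⟩
  filter_upwards [h] with ε hε I hI using hε I hI

theorem ncard_strictTopK_le {N D K : ℕ} (hD : 1 ≤ D) (hDN : D ≤ N) (hK : 1 ≤ K) (hKN : K ≤ N)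
    (V : Matrix (Fin N) (Fin D) ℝ) :
    (strictTopK V K).ncard ≤ N.choose D * D.choose (D / 2) * 2 ^ (D - 1) := by
  rcases hKN.lt_or_eq with hKN | rfl
  · obtain ⟨ε, hinj, hsub⟩ := ((eventually_injective_add_smul hDN V).and
      (eventually_strictTopK_subset V _ K)).exists
    exact (Set.ncard_le_ncard hsub (Set.toFinite _)).trans
      (ncard_strictTopK_le_of_injective hD hK hKN _ hinj)
  · have hsub : strictTopK V K ⊆ {Finset.univ} := fun I hI =>
      (Finset.card_eq_iff_eq_univ I).1 (by simpa using hI.1)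
    refine (Set.ncard_le_ncard hsub (Set.toFinite _)).trans ?_
    rw [Set.ncard_singleton]
    exact Nat.mul_pos (Nat.mul_pos (Nat.choose_pos hDN) (Nat.choose_pos (Nat.div_le_self D 2)))
      (by positivity)

theorem stmt13 (N K D : ℕ) (hD : 2 ≤ D) (hDN : D ≤ N) (hK : 1 ≤ K) (hKN : K ≤ N)
    (V : Matrix (Fin N) (Fin D) ℝ)
    (hgen : ∀ m : ℕ, ∀ hm2 : 2 ≤ m, ∀ hmD : m ≤ D, m % 2 = D % 2 →
      ∀ ι : Fin m → Fin N, StrictMono ι →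
      ∀ s : Fin (m - 1) → ℝ, (∀ r, s r = 1 ∨ s r = -1) →
      (Matrix.of (fun (r : Fin (m - 1)) (k : Fin m) =>
          V (ι ⟨0, by omega⟩) (Fin.castLE hmD k) -
            s r * V (ι ⟨r.1 + 1, by have := r.isLt; omega⟩) (Fin.castLE hmD k))).rank
        = m - 1) :
    ({I : Finset (Fin N) | I.card = K ∧
        ∃ c : Fin D → ℝ, (∑ k, c k ^ 2) = 1 ∧
          ∀ i ∈ I, ∀ j ∉ I, |(V *ᵥ c) j| < |(V *ᵥ c) i|}).ncard ≤
      ∑ d ∈ Finset.range ((D - 1) / 2 + 1),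
        N.choose (D - 2 * d) * (D - 2 * d).choose (D / 2 - d) * 2 ^ (D - 1 - 2 * d) := by
  have hsub : {I : Finset (Fin N) | I.card = K ∧
      ∃ c : Fin D → ℝ, (∑ k, c k ^ 2) = 1 ∧
        ∀ i ∈ I, ∀ j ∉ I, |(V *ᵥ c) j| < |(V *ᵥ c) i|} ⊆ strictTopK V K :=
    fun I ⟨hI, c, _, hc⟩ => ⟨hI, c, hc⟩
  refine (Set.ncard_le_ncard hsub (Set.toFinite _)).trans ?_
  refine (ncard_strictTopK_le (by omega) hDN hK hKN V).trans ?_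
  exact Finset.single_le_sum (f := fun d =>
    N.choose (D - 2 * d) * (D - 2 * d).choose (D / 2 - d) * 2 ^ (D - 1 - 2 * d))
    (fun _ _ => Nat.zero_le _) (Finset.mem_range.2 (Nat.succ_pos _))
end
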